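/- Stationary-phase kernel decay: let η be a compactly supported smooth function on ℝ^n and φ a smooth real-valued function such that the Hessian matrix Hφ has rank at least k at every point of the support of η. Then for all (x,t) ∈ ℝ^{n+1}, |∫_{ℝ^n} e^{i(x·ξ + tφ(ξ))} η(ξ) dξ| ≤ C (1 + |(x,t)|)^{-k/2} for some constant C independent of (x,t). -/

import Mathlib

open MeasureTheory Set

noncomputable section

/-- The Hessian matrix `(∂²φ/∂ξᵢ∂ξⱼ)` of `φ : ℝⁿ → ℝ` at a point. -/
def hess (n : ℕ) (φ : (Fin n → ℝ) → ℝ) (x : Fin n → ℝ) : Matrix (Fin n) (Fin n) ℝ :=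
  fun i j => fderiv ℝ (fun y => fderiv ℝ φ y (Pi.single j 1)) x (Pi.single i 1)

open scoped ContDiff ComplexConjugate

section Families

variable {ι E F G : Type*} [NormedAddCommGroup E] [NormedSpace ℝ E]
  [NormedAddCommGroup F] [NormedSpace ℝ F] [NormedAddCommGroup G] [NormedSpace ℝ G]

/-- A family of smooth functions all of whose derivatives are bounded uniformly in the family. -/
def UniformlySmooth (f : ι → E → F) : Prop :=
  (∀ i, ContDiff ℝ ∞ (f i)) ∧ ∀ m : ℕ, ∃ C : ℝ, ∀ i x, ‖iteratedFDeriv ℝ m (f i) x‖ ≤ C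

namespace UniformlySmooth

lemma exists_norm_le {f : ι → E → F} (hf : UniformlySmooth f) : ∃ C : ℝ, ∀ i x, ‖f i x‖ ≤ C := by
  simpa using hf.2 0

lemma exists_bound_le {f : ι → E → F} (hf : UniformlySmooth f) (m : ℕ) :
    ∃ C : ℝ, 1 ≤ C ∧ ∀ j ≤ m, ∀ i x, ‖iteratedFDeriv ℝ j (f i) x‖ ≤ C := by
  choose C hC using hf.2
  refine ⟨1 + ∑ j ∈ Finset.range (m + 1), |C j|, ?_, fun j hj i x => ?_⟩
  · have : 0 ≤ ∑ j ∈ Finset.range (m + 1), |C j| := Finset.sum_nonneg fun _ _ => abs_nonneg _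
    linarith
  · have h := Finset.single_le_sum (f := fun j => |C j|) (fun _ _ => abs_nonneg _)
      (Finset.mem_range.2 (Nat.lt_succ_of_le hj))
    have := hC j i x
    have := le_abs_self (C j)
    linarith

lemma of_hasCompactSupport {f : E → F} (hf : ContDiff ℝ ∞ f) (hc : HasCompactSupport f) :
    UniformlySmooth fun _ : ι => f := by
  refine ⟨fun _ => hf, fun m => ?_⟩
  obtain ⟨C, hC⟩ := (hf.continuous_iteratedFDeriv (m := m) (by exact_mod_cast le_top)
    ).bounded_above_of_compact_support (hc.iteratedFDeriv m)
  exact ⟨C, fun _ => hC⟩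

lemma const {c : ι → F} {R : ℝ} (hc : ∀ i, ‖c i‖ ≤ R) :
    UniformlySmooth fun (i : ι) (_ : E) => c i := by
  refine ⟨fun _ => contDiff_const, fun m => ⟨R, fun i x => ?_⟩⟩
  rcases Nat.eq_zero_or_pos m with rfl | hm
  · simpa using hc i
  · rw [iteratedFDeriv_const_of_ne hm.ne']
    simpa using (norm_nonneg _).trans (hc i)

lemma add {f g : ι → E → F} (hf : UniformlySmooth f) (hg : UniformlySmooth g) :
    UniformlySmooth fun i x => f i x + g i x := by
  refine ⟨fun i => (hf.1 i).add (hg.1 i), fun m => ?_⟩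
  obtain ⟨C, hC⟩ := hf.2 m
  obtain ⟨D, hD⟩ := hg.2 m
  refine ⟨C + D, fun i x => ?_⟩
  have h := iteratedFDeriv_add_apply
    (((hf.1 i).of_le (by exact_mod_cast le_top)).contDiffAt (x := x))
    (((hg.1 i).of_le (by exact_mod_cast le_top)).contDiffAt (x := x)) (i := m)
  exact (congrArg norm h).le.trans (norm_add_le_of_le (hC i x) (hD i x))

lemma smul {𝕜 : Type*} [NormedField 𝕜] [NormedAlgebra ℝ 𝕜] [NormedSpace 𝕜 F]
    [IsScalarTower ℝ 𝕜 F] {f : ι → E → 𝕜} {g : ι → E → F}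
    (hf : UniformlySmooth f) (hg : UniformlySmooth g) :
    UniformlySmooth fun i x => f i x • g i x := by
  refine ⟨fun i => (hf.1 i).smul (hg.1 i), fun m => ?_⟩
  obtain ⟨C, hC1, hC⟩ := hf.exists_bound_le m
  obtain ⟨D, hD1, hD⟩ := hg.exists_bound_le m
  refine ⟨∑ j ∈ Finset.range (m + 1), (m.choose j : ℝ) * C * D, fun i x => ?_⟩
  refine (norm_iteratedFDeriv_smul_le (hf.1 i) (hg.1 i) x (n := m)
    (by exact_mod_cast le_top)).trans (Finset.sum_le_sum fun j hj => ?_)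
  have hj := Finset.mem_range_succ_iff.1 hj
  have := hC j hj i x
  have := hD (m - j) (Nat.sub_le _ _) i x
  gcongr

lemma fderiv_apply {f : ι → E → F} (hf : UniformlySmooth f) {u : ι → E} {R : ℝ}
    (hu : ∀ i, ‖u i‖ ≤ R) : UniformlySmooth fun i x => fderiv ℝ (f i) x (u i) := by
  have hs : ∀ i, ContDiff ℝ ∞ (fderiv ℝ (f i)) := fun i => (hf.1 i).fderiv_right (by simp)
  refine ⟨fun i => (hs i).clm_apply contDiff_const, fun m => ?_⟩
  obtain ⟨C, hC⟩ := hf.2 (m + 1)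
  refine ⟨R * C, fun i x => ?_⟩
  refine (norm_iteratedFDeriv_clm_apply_const (hs i).contDiffAt (n := m)
    (by exact_mod_cast le_top)).trans ?_
  rw [norm_iteratedFDeriv_fderiv]
  exact mul_le_mul (hu i) (hC i x) (norm_nonneg _) ((norm_nonneg _).trans (hu i))

lemma comp_left [ProperSpace F] {f : ι → E → F} (hf : UniformlySmooth f) {χ : F → G}
    (hχ : ContDiff ℝ ∞ χ) : UniformlySmooth fun i x => χ (f i x) := by
  refine ⟨fun i => hχ.comp (hf.1 i), fun m => ?_⟩
  obtain ⟨D, hD1, hD⟩ := hf.exists_bound_le m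
  have hb : ∀ j : ℕ, ∃ C, ∀ y ∈ Metric.closedBall (0 : F) D, ‖iteratedFDeriv ℝ j χ y‖ ≤ C :=
    fun j => (isCompact_closedBall (0 : F) D).exists_bound_of_continuousOn
      (hχ.continuous_iteratedFDeriv (m := j) (by exact_mod_cast le_top)).continuousOn
  choose C hC using hb
  refine ⟨m.factorial * (∑ j ∈ Finset.range (m + 1), |C j|) * D ^ m, fun i x => ?_⟩
  refine norm_iteratedFDeriv_comp_le hχ (hf.1 i) (by exact_mod_cast le_top) x
    (fun j hj => ?_) (fun j hj1 hj => (hD j hj i x).trans (le_self_pow₀ hD1 (by omega)))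
  have h := Finset.single_le_sum (f := fun j => |C j|) (fun _ _ => abs_nonneg _)
    (Finset.mem_range.2 (Nat.lt_succ_of_le hj))
  have h0 := hD 0 (Nat.zero_le _) i x
  rw [norm_iteratedFDeriv_zero] at h0
  exact ((hC j _ (by simpa using h0)).trans (le_abs_self _)).trans h

lemma comp_add {f : ι → E → F} (hf : UniformlySmooth f) (h : ι → E) :
    UniformlySmooth fun i x => f i (x + h i) := by
  refine ⟨fun i => (hf.1 i).comp (contDiff_id.add contDiff_const), fun m => ?_⟩
  obtain ⟨C, hC⟩ := hf.2 m
  refine ⟨C, fun i x => ?_⟩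
  rw [iteratedFDeriv_comp_add_right]
  exact hC i _

lemma const_smul {f : ι → E → F} (hf : UniformlySmooth f) {c : ι → ℝ} {R : ℝ}
    (hc : ∀ i, ‖c i‖ ≤ R) : UniformlySmooth fun i x => c i • f i x :=
  (UniformlySmooth.const hc).smul hf

lemma differenceQuotient {f : E → F} (hf : UniformlySmooth fun _ : ι => f) {h : ι → E}
    {c : ι → ℝ} {R : ℝ} (hc : ∀ i, |c i| * ‖h i‖ ≤ R) :
    UniformlySmooth fun i x => c i • (f (x + h i) - f x) := by
  rcases isEmpty_or_nonempty ι with hι | ⟨⟨i₀⟩⟩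
  · exact ⟨fun i => isEmptyElim i, fun m => ⟨0, fun i => isEmptyElim i⟩⟩
  have hf1 : ContDiff ℝ ∞ f := hf.1 i₀
  have ht : ∀ v : E, ContDiff ℝ ∞ fun x => f (x + v) := fun v =>
    hf1.comp (contDiff_id.add contDiff_const)
  refine ⟨fun i => ((ht _).sub hf1).const_smul (c i), fun m => ?_⟩
  obtain ⟨C, hC⟩ := hf.2 (m + 1)
  have hC := hC i₀
  refine ⟨R * C, fun i x => ?_⟩
  have e1 := iteratedFDeriv_const_smul_apply' (a := c i) (i := m)
    ((((ht (h i)).sub hf1).of_le (by exact_mod_cast le_top)).contDiffAt (x := x))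
  have e2 := fun_iteratedFDeriv_sub_apply
    (((ht (h i)).of_le (by exact_mod_cast le_top)).contDiffAt (x := x))
    ((hf1.of_le (by exact_mod_cast le_top)).contDiffAt (x := x)) (i := m)
  rw [e1, e2, norm_smul, iteratedFDeriv_comp_add_right]
  have hd : Differentiable ℝ (iteratedFDeriv ℝ m f) :=
    hf1.differentiable_iteratedFDeriv (by exact_mod_cast ENat.natCast_lt_top m)
  have hmv := Convex.norm_image_sub_le_of_norm_fderiv_le (f := iteratedFDeriv ℝ m f) (C := C)
    (s := Set.univ) (x := x) (y := x + h i) (fun y _ => hd y)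
    (fun y _ => by rw [norm_fderiv_iteratedFDeriv]; exact hC y) convex_univ trivial trivial
  rw [add_sub_cancel_left] at hmv
  have hC0 : 0 ≤ C := (norm_nonneg _).trans (hC x)
  calc ‖c i‖ * ‖iteratedFDeriv ℝ m f (x + h i) - iteratedFDeriv ℝ m f x‖
      ≤ |c i| * (C * ‖h i‖) := by rw [Real.norm_eq_abs]; gcongr
    _ = |c i| * ‖h i‖ * C := by ring
    _ ≤ R * C := by gcongr; exact hc i

end UniformlySmooth

end Families

lemma exists_smooth_inv {c : ℝ} (hc : 0 < c) :
    ∃ χ : ℝ → ℝ, ContDiff ℝ ∞ χ ∧ ∀ s, c ≤ s → χ s * s = 1 := by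
  let w : ℝ → ℝ := fun s => Real.smoothTransition (2 * s / c - 1)
  have hw : ContDiff ℝ ∞ w := Real.smoothTransition.contDiff.comp (by fun_prop)
  have hpos : ∀ s, w s * s + (1 - w s) * c ≠ 0 := by
    intro s
    have h0 : 0 ≤ w s := Real.smoothTransition.nonneg _
    have h1 : w s ≤ 1 := Real.smoothTransition.le_one _
    rcases le_or_gt s 0 with hs | hs
    · have : w s = 0 := Real.smoothTransition.zero_of_nonpos (by
        have : 2 * s / c ≤ 0 := div_nonpos_of_nonpos_of_nonneg (by linarith) hc.le
        linarith)
      simp [this, hc.ne']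
    · refine ne_of_gt ?_
      rcases h0.eq_or_lt with h | h
      · simp [← h, hc]
      · have := mul_pos h hs
        have := mul_nonneg (sub_nonneg.2 h1) hc.le
        linarith
  refine ⟨fun s => (w s * s + (1 - w s) * c)⁻¹, ContDiff.inv (by fun_prop) hpos, fun s hs => ?_⟩
  have : w s = 1 := Real.smoothTransition.one_of_one_le (by
    have : 2 ≤ 2 * s / c := by rw [le_div_iff₀ hc]; linarith
    linarith)
  have hs0 : s ≠ 0 := by linarith
  simp [this, hs0]

section Oscillatory

variable {ι E : Type*} [NormedAddCommGroup E] [NormedSpace ℝ E]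

/-- The unimodular oscillating factor `e^{iθ}`. -/
def osc (θ : ℝ) : ℂ := Complex.exp (Complex.I * (θ : ℂ))

@[simp] lemma norm_osc (θ : ℝ) : ‖osc θ‖ = 1 := by
  rw [osc, mul_comm]; exact Complex.norm_exp_ofReal_mul_I θ

lemma osc_add (θ θ' : ℝ) : osc (θ + θ') = osc θ * osc θ' := by
  simp only [osc, Complex.ofReal_add, mul_add, Complex.exp_add]

lemma conj_osc (θ : ℝ) : conj (osc θ) = osc (-θ) := by
  simp [osc, ← Complex.exp_conj]

lemma contDiff_osc : ContDiff ℝ ∞ osc :=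
  Complex.contDiff_exp.comp (contDiff_const.mul Complex.ofRealCLM.contDiff)

lemma fderiv_osc_comp {ψ : E → ℝ} {x : E} (hψ : DifferentiableAt ℝ ψ x) (s : ℝ) (u : E) :
    fderiv ℝ (fun y => osc (s * ψ y)) x u =
      Complex.I * s * fderiv ℝ ψ x u * osc (s * ψ x) := by
  have h := ((Complex.ofRealCLM.hasFDerivAt.comp x (hψ.hasFDerivAt.const_mul s)).const_mul
    Complex.I).cexp
  have h' : HasFDerivAt (fun y => osc (s * ψ y)) _ x := h
  rw [h'.fderiv]
  simp [osc]
  ring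

lemma norm_integral_le_of_support_subset {X F : Type*} [TopologicalSpace X] [MeasurableSpace X]
    {μ : Measure X} [IsFiniteMeasureOnCompacts μ] [NormedAddCommGroup F] [NormedSpace ℝ F]
    {f : X → F} {K : Set X} (hK : IsCompact K) (hf : Function.support f ⊆ K) {C : ℝ}
    (hC : ∀ x, ‖f x‖ ≤ C) : ‖∫ x, f x ∂μ‖ ≤ C * μ.real K := by
  rw [← setIntegral_eq_integral_of_forall_compl_eq_zero (s := K)
    (fun x hx => by_contra fun h => hx (hf h))]
  exact norm_setIntegral_le_of_norm_le_const hK.measure_lt_top fun x _ => hC x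

variable [FiniteDimensional ℝ E] [MeasurableSpace E] [BorelSpace E]

/-- One integration by parts in an oscillatory integral, in a direction `u` along which the phase
has no critical points on the support of the amplitude. -/
lemma integral_osc_mul_eq {μ : Measure E} [μ.IsAddHaarMeasure] {ψ ρ : E → ℝ} {a : E → ℂ}
    (hψ : ContDiff ℝ ∞ ψ) (hρ : ContDiff ℝ ∞ ρ) (ha : ContDiff ℝ ∞ a) (hc : HasCompactSupport a)
    (u : E) (h1 : ∀ x ∈ tsupport a, ρ x * fderiv ℝ ψ x u = 1) (s : ℝ) :
    (Complex.I * s) * ∫ x, osc (s * ψ x) * a x ∂μ =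
      - ∫ x, osc (s * ψ x) * fderiv ℝ (fun y => ρ y • a y) x u ∂μ := by
  have hosc : ContDiff ℝ ∞ fun x => osc (s * ψ x) := contDiff_osc.comp (contDiff_const.mul hψ)
  have hb : ContDiff ℝ ∞ fun y => ρ y • a y := hρ.smul ha
  have hbc : HasCompactSupport fun y => ρ y • a y := hc.smul_left (f := ρ)
  have hb' : Continuous fun x => fderiv ℝ (fun y => ρ y • a y) x u :=
    (hb.continuous_fderiv (by simp)).clm_apply continuous_const
  have ho' : Continuous fun x => fderiv ℝ (fun y => osc (s * ψ y)) x u :=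
    (hosc.continuous_fderiv (by simp)).clm_apply continuous_const
  rw [integral_mul_fderiv_eq_neg_fderiv_mul_of_integrable
    ((ho'.mul hb.continuous).integrable_of_hasCompactSupport hbc.mul_left)
    ((hosc.continuous.mul hb').integrable_of_hasCompactSupport
      ((hbc.fderiv_apply (𝕜 := ℝ) u).mul_left))
    ((hosc.continuous.mul hb.continuous).integrable_of_hasCompactSupport hbc.mul_left)
    (fun x _ => hosc.differentiable (by simp) x) (fun x _ => hb.differentiable (by simp) x),
    neg_neg, ← integral_const_mul]
  congr 1 with x
  rw [fderiv_osc_comp (hψ.differentiable (by simp) x)]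
  by_cases hx : x ∈ tsupport a
  · have := congrArg (fun r : ℝ => (r : ℂ)) (h1 x hx)
    push_cast at this
    rw [Complex.real_smul]
    linear_combination (- Complex.I * s * osc (s * ψ x) * a x) * this
  · simp [image_eq_zero_of_notMem_tsupport hx]

/-- Uniform rapid decay of oscillatory integrals without critical points. -/
lemma exists_pow_mul_norm_integral_osc_le (μ : Measure E) [μ.IsAddHaarMeasure]
    {ψ : ι → E → ℝ} {u : ι → E} {K : Set E} {c R : ℝ} (hK : IsCompact K)
    (hψ : ∀ i, ContDiff ℝ ∞ (ψ i)) (hu : ∀ i, ‖u i‖ ≤ R)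
    (hg : UniformlySmooth fun i x => fderiv ℝ (ψ i) x (u i)) (hc : 0 < c) (N : ℕ) :
    ∀ {a : ι → E → ℂ}, UniformlySmooth a → (∀ i, tsupport (a i) ⊆ K) →
      (∀ i, ∀ x ∈ tsupport (a i), c ≤ fderiv ℝ (ψ i) x (u i)) →
      ∃ C : ℝ, ∀ i (s : ℝ), |s| ^ N * ‖∫ x, osc (s * ψ i x) * a i x ∂μ‖ ≤ C := by
  obtain ⟨χ, hχ, hχ1⟩ := exists_smooth_inv hc
  induction N with
  | zero =>
    intro a ha hs _
    obtain ⟨C, hC⟩ := ha.exists_norm_le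
    refine ⟨C * μ.real K, fun i s => ?_⟩
    rw [pow_zero, one_mul]
    refine norm_integral_le_of_support_subset hK ?_ fun x => by simpa using hC i x
    exact fun x hx => hs i (subset_tsupport _ (right_ne_zero_of_mul hx))
  | succ N ih =>
    intro a ha hs hca
    have hρ : UniformlySmooth fun i x => χ (fderiv ℝ (ψ i) x (u i)) := hg.comp_left hχ
    have hsub : ∀ i, tsupport (fun x => fderiv ℝ
        (fun y => χ (fderiv ℝ (ψ i) y (u i)) • a i y) x (u i)) ⊆ tsupport (a i) := fun i =>
      (tsupport_fderiv_apply_subset ℝ (u i)).trans (tsupport_smul_subset_right _ _)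
    obtain ⟨C, hC⟩ := ih ((hρ.smul ha).fderiv_apply hu) (fun i => (hsub i).trans (hs i))
      (fun i x hx => hca i x (hsub i hx))
    refine ⟨C, fun i s => ?_⟩
    have h := integral_osc_mul_eq (μ := μ) (hψ i) (hρ.1 i) (ha.1 i)
      (hK.of_isClosed_subset (isClosed_tsupport _) (hs i)) (u i)
      (fun x hx => hχ1 _ (hca i x hx)) s
    have h' := congrArg norm h
    rw [norm_mul, norm_neg] at h'
    have e : ‖Complex.I * (s : ℂ)‖ = |s| := by simp
    rw [e] at h'
    rw [pow_succ, mul_assoc, h']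
    exact hC i s

end Oscillatory

section VanDerCorput

lemma norm_integral_sq_le {X : Type*} [TopologicalSpace X] [MeasurableSpace X]
    [OpensMeasurableSpace X] [T2Space X] {μ : Measure X} [IsFiniteMeasureOnCompacts μ]
    {f : X → ℂ} {K : Set X} (hK : IsCompact K) (hf : Continuous f) (hs : Function.support f ⊆ K) :
    ‖∫ x, f x ∂μ‖ ^ 2 ≤ (μ.real K + 1) * ∫ x, ‖f x‖ ^ 2 ∂μ := by
  set m := ‖∫ x, f x ∂μ‖ with hm
  set V := μ.real K with hV
  have hV0 : 0 ≤ V := measureReal_nonneg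
  have e1 : ∫ x, f x ∂μ = ∫ x in K, f x ∂μ :=
    (setIntegral_eq_integral_of_forall_compl_eq_zero
      (fun x hx => by_contra fun h => hx (hs h))).symm
  have e2 : ∫ x, ‖f x‖ ^ 2 ∂μ = ∫ x in K, ‖f x‖ ^ 2 ∂μ :=
    (setIntegral_eq_integral_of_forall_compl_eq_zero
      (fun x hx => by simpa using by_contra fun h => hx (hs h))).symm
  have i1 : IntegrableOn (fun x => ‖f x‖) K μ := hf.norm.continuousOn.integrableOn_compact hK
  have i2 : IntegrableOn (fun x => ‖f x‖ ^ 2) K μ :=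
    (hf.norm.pow 2).continuousOn.integrableOn_compact hK
  set l := m / (V + 1) with hl
  have hi : ∫ x in K, 2 * l * ‖f x‖ ∂μ ≤ ∫ x in K, (‖f x‖ ^ 2 + l ^ 2) ∂μ := by
    refine integral_mono (i1.const_mul _)
      (i2.add (integrableOn_const hK.measure_lt_top.ne)) fun x => ?_
    have := sq_nonneg (‖f x‖ - l)
    simp only
    nlinarith
  rw [integral_const_mul, integral_add i2 (integrableOn_const hK.measure_lt_top.ne), ← e2,
    setIntegral_const, smul_eq_mul] at hi
  have hmi : m ≤ ∫ x in K, ‖f x‖ ∂μ := by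
    rw [hm, e1]; exact norm_integral_le_integral_norm _
  have hl0 : 0 ≤ l := by positivity
  have hml : m = l * (V + 1) := by rw [hl]; field_simp
  have h3 := mul_le_mul_of_nonneg_left hmi (mul_nonneg zero_le_two hl0)
  have h4 : 2 * l * m ≤ ∫ x, ‖f x‖ ^ 2 ∂μ + V * l ^ 2 := h3.trans hi
  have h5 : l ^ 2 * (V + 1) ≤ ∫ x, ‖f x‖ ^ 2 ∂μ := by
    rw [hml] at h4
    nlinarith [sq_nonneg l]
  rw [hml]
  calc (l * (V + 1)) ^ 2 = (V + 1) * (l ^ 2 * (V + 1)) := by ring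
    _ ≤ _ := by gcongr

variable {E V : Type*} [NormedAddCommGroup E] [NormedSpace ℝ E] [FiniteDimensional ℝ E]
  [MeasurableSpace E] [BorelSpace E] [NormedAddCommGroup V] [NormedSpace ℝ V]
  [FiniteDimensional ℝ V] [MeasurableSpace V] [BorelSpace V]

/-- The van der Corput differencing inequality: an integral is controlled by the autocorrelations of
the integrand along the range of a linear map. -/
lemma exists_norm_integral_sq_le_autocorrelation (μ : Measure E) [μ.IsAddHaarMeasure]
    (ν : Measure V) [ν.IsAddHaarMeasure] (A : V →L[ℝ] E) {K : Set E} (hK : IsCompact K) :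
    ∃ C : ℝ, 0 ≤ C ∧ ∀ (F : E → ℂ) (H : V → ℝ), Continuous F → Function.support F ⊆ K →
      Integrable H ν → (∀ z, ‖∫ ξ, F (ξ + A z) * conj (F ξ) ∂μ‖ ≤ H z) →
      ‖∫ ξ, F ξ ∂μ‖ ^ 2 ≤ C * ∫ z, H z ∂ν := by
  obtain ⟨θ, hθ, hθc, hθ0, hθ1⟩ : ∃ θ : V → ℝ, Continuous θ ∧ HasCompactSupport θ ∧
      (∀ v, 0 ≤ θ v) ∧ ∫ v, θ v ∂ν = 1 := by
    let f : ContDiffBump (0 : V) := ⟨1, 2, one_pos, one_lt_two⟩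
    exact ⟨f.normed ν, f.continuous_normed, f.hasCompactSupport_normed, f.nonneg_normed,
      f.integral_normed⟩
  have hθi : Integrable θ ν := hθ.integrable_of_hasCompactSupport hθc
  obtain ⟨Θ, hΘ⟩ := hθ.bounded_above_of_compact_support hθc
  have hΘ0 : 0 ≤ Θ := (norm_nonneg _).trans (hΘ 0)
  set T := tsupport θ with hT
  let K' : Set E := (fun p : E × V => p.1 - A p.2) '' (K ×ˢ T)
  have hK' : IsCompact K' := (hK.prod hθc).image (by fun_prop)
  refine ⟨(μ.real K' + 1) * Θ, by positivity, fun F H hF hFK hH hFH => ?_⟩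
  have hsub : ∀ v ξ, (θ v : ℂ) * F (ξ + A v) ≠ 0 → v ∈ T ∧ ξ ∈ K' := fun v ξ h =>
    have h1 : v ∈ T := subset_tsupport _ (by simpa using left_ne_zero_of_mul h)
    ⟨h1, ⟨(ξ + A v, v), ⟨hFK (right_ne_zero_of_mul h), h1⟩, by simp⟩⟩
  have hcs : ∀ f : E → V → ℂ, (∀ ξ v, (θ v : ℂ) * F (ξ + A v) = 0 → f ξ v = 0) →
      HasCompactSupport (Function.uncurry f) := fun f hf =>
    HasCompactSupport.intro (hK'.prod hθc) fun p hp => by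
      refine hf _ _ (by_contra fun h => hp ?_)
      exact ⟨(hsub _ _ h).2, (hsub _ _ h).1⟩
  have hconj : Continuous fun z : ℂ => conj z := Complex.continuous_conj
  let S : E → ℂ := fun ξ => ∫ v, (θ v : ℂ) * F (ξ + A v) ∂ν
  have hSc : Continuous S := by
    have : S = fun ξ => ∫ v in T, (θ v : ℂ) * F (ξ + A v) ∂ν := by
      ext ξ
      exact (setIntegral_eq_integral_of_forall_compl_eq_zero
        (fun v hv => by_contra fun h => hv (hsub v ξ h).1)).symm
    rw [this]
    exact continuous_parametric_integral_of_continuous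
      (f := fun ξ v => (θ v : ℂ) * F (ξ + A v)) (by fun_prop) hθc
  have hSs : Function.support S ⊆ K' := fun ξ hξ => by
    by_contra h
    refine hξ (integral_eq_zero_of_ae (Filter.Eventually.of_forall fun v => ?_))
    exact by_contra fun h' => h (hsub v ξ h').2
  have hS : ∫ ξ, S ξ ∂μ = ∫ ξ, F ξ ∂μ := by
    have := integral_integral_swap_of_hasCompactSupport (μ := μ) (ν := ν)
      (f := fun ξ v => (θ v : ℂ) * F (ξ + A v)) (by fun_prop) (hcs _ fun _ _ h => h)
    refine this.trans ?_
    simp_rw [integral_const_mul, integral_add_right_eq_self, integral_mul_const]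
    rw [integral_complex_ofReal, hθ1]
    simp
  have hG : ∀ v, ‖∫ ξ, F (ξ + A v) * conj (S ξ) ∂μ‖ ≤ Θ * ∫ z, H z ∂ν := by
    intro v
    have e1 : ∀ ξ, F (ξ + A v) * conj (S ξ) =
        ∫ v', F (ξ + A v) * ((θ v' : ℂ) * conj (F (ξ + A v'))) ∂ν := fun ξ => by
      rw [integral_const_mul, ← integral_conj]
      simp
    simp_rw [e1]
    rw [integral_integral_swap_of_hasCompactSupport
      (f := fun ξ v' => F (ξ + A v) * ((θ v' : ℂ) * conj (F (ξ + A v')))) (by fun_prop)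
      (hcs _ fun ξ v' h => by rcases mul_eq_zero.1 h with h | h <;> simp [h])]
    have e2 : ∫ z, H z ∂ν = ∫ v', H (v - v') ∂ν := (integral_sub_left_eq_self H ν v).symm
    rw [e2, ← integral_const_mul]
    refine norm_integral_le_of_norm_le ((hH.comp_sub_left v).const_mul Θ)
      (Filter.Eventually.of_forall fun v' => ?_)
    have e3 : ∫ ξ, F (ξ + A v) * ((θ v' : ℂ) * conj (F (ξ + A v'))) ∂μ =
        (θ v' : ℂ) * ∫ ξ, F (ξ + A (v - v')) * conj (F ξ) ∂μ := by
      rw [← integral_const_mul, ← integral_add_right_eq_self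
        (fun ξ => (θ v' : ℂ) * (F (ξ + A (v - v')) * conj (F ξ))) (A v')]
      congr 1 with ξ
      rw [map_sub, add_add_sub_cancel]
      ring
    rw [e3, norm_mul, Complex.norm_real]
    exact mul_le_mul (hΘ v') (hFH _) (norm_nonneg _) hΘ0
  have hQ : ∫ ξ, ‖S ξ‖ ^ 2 ∂μ ≤ Θ * ∫ z, H z ∂ν := by
    have e1 : ((∫ ξ, ‖S ξ‖ ^ 2 ∂μ : ℝ) : ℂ) =
        ∫ ξ, ∫ v, ((θ v : ℂ) * F (ξ + A v)) * conj (S ξ) ∂ν ∂μ := by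
      rw [← integral_complex_ofReal]
      congr 1 with ξ
      rw [integral_mul_const]
      simpa using (Complex.mul_conj' (S ξ)).symm
    rw [integral_integral_swap_of_hasCompactSupport
      (f := fun ξ v => ((θ v : ℂ) * F (ξ + A v)) * conj (S ξ)) (by fun_prop)
      (hcs _ fun ξ v h => by simp [h])] at e1
    refine (le_abs_self _).trans ?_
    rw [← Real.norm_eq_abs, ← Complex.norm_real, e1, ← one_mul (Θ * _), ← hθ1, ← integral_mul_const]
    refine norm_integral_le_of_norm_le (hθi.mul_const _)
      (Filter.Eventually.of_forall fun v => ?_)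
    simp_rw [mul_assoc]
    rw [integral_const_mul, norm_mul, Complex.norm_real, Real.norm_of_nonneg (hθ0 v)]
    exact mul_le_mul_of_nonneg_left (hG v) (hθ0 v)
  rw [← hS, mul_assoc]
  exact (norm_integral_sq_le hK' hSc hSs).trans (by gcongr)

end VanDerCorput

section Decay

variable {E V : Type*} [NormedAddCommGroup E] [NormedSpace ℝ E]
  [NormedAddCommGroup V] [NormedSpace ℝ V]

lemma exists_norm_le_one_lt_apply {L : E →L[ℝ] ℝ} {r : ℝ} (h : r < ‖L‖) :
    ∃ u : E, ‖u‖ ≤ 1 ∧ r < L u := by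
  obtain ⟨u, hu, hr⟩ := L.exists_lt_apply_of_lt_opNorm h
  rcases le_total 0 (L u) with h0 | h0
  · exact ⟨u, hu.le, by rwa [Real.norm_of_nonneg h0] at hr⟩
  · exact ⟨-u, by simpa using hu.le, by rwa [Real.norm_of_nonpos h0, ← map_neg] at hr⟩

/-- Near a point where the second derivative of the phase is injective on the range of `A`, the
gradient of the difference `φ (ξ + A z) - φ ξ` is bounded below by a multiple of `‖z‖`. -/
lemma exists_fderiv_difference_lower_bound [FiniteDimensional ℝ V] {φ : E → ℝ}
    (hφ : ContDiff ℝ ∞ φ) {ξ₀ : E} (A : V →L[ℝ] E)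
    (hA : Function.Injective fun z => fderiv ℝ (fderiv ℝ φ) ξ₀ (A z)) :
    ∃ r > 0, ∃ c > 0, ∀ z : V, z ≠ 0 → ∃ u : E, ‖u‖ ≤ 1 ∧
      ∀ ξ ∈ Metric.closedBall ξ₀ r, ξ + A z ∈ Metric.closedBall ξ₀ r →
        c * ‖z‖ ≤ fderiv ℝ φ (ξ + A z) u - fderiv ℝ φ ξ u := by
  set B := fderiv ℝ (fderiv ℝ φ) ξ₀ with hB
  obtain ⟨K, hK0, hK⟩ := ((B ∘L A : V →L[ℝ] E →L[ℝ] ℝ) : V →ₗ[ℝ] E →L[ℝ] ℝ).exists_antilipschitzWith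
    (LinearMap.ker_eq_bot.2 hA)
  have hKz : ∀ z, ‖z‖ ≤ K * ‖B (A z)‖ := fun z => ZeroHomClass.bound_of_antilipschitz _ hK z
  let c : ℝ := (K : ℝ)⁻¹
  have hc : 0 < c := inv_pos.2 hK0
  let ε : NNReal := ⟨c / (4 * (‖A‖ + 1)), by positivity⟩
  have hε : 0 < ε := by
    have : 0 < c / (4 * (‖A‖ + 1)) := by positivity
    exact this
  have hst : HasStrictFDerivAt (fderiv ℝ φ) B ξ₀ :=
    ((hφ.fderiv_right (m := ∞) (by simp)).contDiffAt).hasStrictFDerivAt (by simp)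
  obtain ⟨s, hs, happ⟩ := hst.approximates_deriv_on_nhds (c := ε) (Or.inr hε)
  obtain ⟨r, hr, hrs⟩ := Metric.nhds_basis_closedBall.mem_iff.1 hs
  refine ⟨r, hr, c / 4, by positivity, fun z hz => ?_⟩
  have hz0 : 0 < ‖z‖ := norm_pos_iff.2 hz
  have hlt : c / 2 * ‖z‖ < ‖B (A z)‖ := by
    have h1 : c * ‖z‖ ≤ ‖B (A z)‖ := (inv_mul_le_iff₀ (by exact_mod_cast hK0)).2 (hKz z)
    have := mul_pos hc hz0
    linarith
  obtain ⟨u, hu1, hu⟩ := exists_norm_le_one_lt_apply hlt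
  refine ⟨u, hu1, fun ξ h1 h2 => ?_⟩
  have h3 := happ _ (hrs h2) _ (hrs h1)
  rw [add_sub_cancel_left] at h3
  have h4 : |fderiv ℝ φ (ξ + A z) u - fderiv ℝ φ ξ u - B (A z) u| ≤ c / 4 * ‖z‖ := by
    refine ((fderiv ℝ φ (ξ + A z) - fderiv ℝ φ ξ - B (A z)).unit_le_opNorm u hu1).trans
      (h3.trans ?_)
    have h5 : ‖A z‖ ≤ (‖A‖ + 1) * ‖z‖ := (A.le_opNorm z).trans (by gcongr; linarith)
    have h6 : (ε : ℝ) * (‖A‖ + 1) = c / 4 := by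
      change c / (4 * (‖A‖ + 1)) * (‖A‖ + 1) = c / 4
      have : ‖A‖ + 1 ≠ 0 := by positivity
      field_simp
    calc (ε : ℝ) * ‖A z‖ ≤ ε * ((‖A‖ + 1) * ‖z‖) := by gcongr
      _ = c / 4 * ‖z‖ := by rw [← mul_assoc, h6]
  linarith [(abs_le.1 h4).1]

variable [MeasurableSpace E]

/-- The oscillatory integral `∫ e^{i(ℓ(ξ) + tφ(ξ))} η(ξ) dξ`. -/
def oscIntegral (μ : Measure E) (φ : E → ℝ) (η : E → ℂ) (l : E →L[ℝ] ℝ) (t : ℝ) : ℂ :=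
  ∫ ξ, osc (l ξ + t * φ ξ) * η ξ ∂μ

/-- Decay of order `k / 2` of the oscillatory integral, uniformly in all directions. -/
def HasDecay (μ : Measure E) (φ : E → ℝ) (k : ℕ) (η : E → ℂ) : Prop :=
  ∃ C : ℝ, ∀ (l : E →L[ℝ] ℝ) (t : ℝ), (1 + ‖l‖ + |t|) ^ k * ‖oscIntegral μ φ η l t‖ ^ 2 ≤ C

variable {μ : Measure E} [μ.IsAddHaarMeasure] {φ : E → ℝ} {η : E → ℂ}

lemma exists_norm_oscIntegral_le (hη : ContDiff ℝ ∞ η) (hc : HasCompactSupport η) :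
    ∃ C : ℝ, ∀ l t, ‖oscIntegral μ φ η l t‖ ≤ C := by
  obtain ⟨C, hC⟩ := hη.continuous.bounded_above_of_compact_support hc
  exact ⟨C * μ.real (tsupport η), fun l t => norm_integral_le_of_support_subset hc
    (fun x hx => subset_tsupport _ (right_ne_zero_of_mul hx)) fun x => by simpa using hC x⟩

variable [BorelSpace E]

lemma HasDecay.add {k : ℕ} {η₁ η₂ : E → ℂ} (hφ : ContDiff ℝ ∞ φ)
    (h1 : ContDiff ℝ ∞ η₁) (h1c : HasCompactSupport η₁)
    (h2 : ContDiff ℝ ∞ η₂) (h2c : HasCompactSupport η₂)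
    (hd1 : HasDecay μ φ k η₁) (hd2 : HasDecay μ φ k η₂) :
    HasDecay μ φ k fun ξ => η₁ ξ + η₂ ξ := by
  obtain ⟨C₁, hC₁⟩ := hd1
  obtain ⟨C₂, hC₂⟩ := hd2
  refine ⟨2 * (C₁ + C₂), fun l t => ?_⟩
  have ho : Continuous fun ξ => osc (l ξ + t * φ ξ) := contDiff_osc.continuous.comp
    (l.continuous.add (continuous_const.mul hφ.continuous))
  have e : oscIntegral μ φ (fun ξ => η₁ ξ + η₂ ξ) l t =
      oscIntegral μ φ η₁ l t + oscIntegral μ φ η₂ l t := by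
    simp only [oscIntegral, mul_add]
    exact integral_add ((ho.mul h1.continuous).integrable_of_hasCompactSupport h1c.mul_left)
      ((ho.mul h2.continuous).integrable_of_hasCompactSupport h2c.mul_left)
  have hn := norm_add_le (oscIntegral μ φ η₁ l t) (oscIntegral μ φ η₂ l t)
  have hq : ‖oscIntegral μ φ (fun ξ => η₁ ξ + η₂ ξ) l t‖ ^ 2 ≤
      2 * (‖oscIntegral μ φ η₁ l t‖ ^ 2 + ‖oscIntegral μ φ η₂ l t‖ ^ 2) := by
    rw [e]
    calc _ ≤ (‖oscIntegral μ φ η₁ l t‖ + ‖oscIntegral μ φ η₂ l t‖) ^ 2 := by gcongr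
      _ ≤ _ := add_sq_le
  calc _ ≤ (1 + ‖l‖ + |t|) ^ k *
        (2 * (‖oscIntegral μ φ η₁ l t‖ ^ 2 + ‖oscIntegral μ φ η₂ l t‖ ^ 2)) := by gcongr
    _ ≤ _ := by linarith [hC₁ l t, hC₂ l t]

variable [FiniteDimensional ℝ E]

/-- Rapid decay in the cone where the linear part of the phase dominates. -/
lemma exists_pow_mul_norm_oscIntegral_le (hφ : ContDiff ℝ ∞ φ) (hφc : HasCompactSupport φ)
    (hη : ContDiff ℝ ∞ η) (hc : HasCompactSupport η) (N : ℕ) :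
    ∃ M : ℝ, 1 ≤ M ∧ ∃ C : ℝ, ∀ (l : E →L[ℝ] ℝ) (t : ℝ), l ≠ 0 → M * |t| ≤ ‖l‖ →
      ‖l‖ ^ N * ‖oscIntegral μ φ η l t‖ ≤ C := by
  obtain ⟨D, hD⟩ := (hφ.continuous_fderiv (by simp)).bounded_above_of_compact_support
    (hφc.fderiv (𝕜 := ℝ))
  have hD0 : 0 ≤ D := (norm_nonneg _).trans (hD 0)
  refine ⟨4 * (D + 1), by linarith, ?_⟩
  let ι := {p : (E →L[ℝ] ℝ) × ℝ // p.1 ≠ 0 ∧ 4 * (D + 1) * |p.2| ≤ ‖p.1‖}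
  have hpos : ∀ p : ι, 0 < ‖p.1.1‖ := fun p => norm_pos_iff.2 p.2.1
  choose u hu1 hu using fun p : ι =>
    exists_norm_le_one_lt_apply (L := p.1.1) (half_lt_self (hpos p))
  let ψ : ι → E → ℝ := fun p ξ => ‖p.1.1‖⁻¹ * (p.1.1 ξ + p.1.2 * φ ξ)
  have hψ : ∀ p, ContDiff ℝ ∞ (ψ p) := fun p => by
    have := p.1.1.contDiff (n := ∞)
    fun_prop
  have hfd : ∀ p x, fderiv ℝ (ψ p) x (u p) =
      ‖p.1.1‖⁻¹ * p.1.1 (u p) + (‖p.1.1‖⁻¹ * p.1.2) • fderiv ℝ φ x (u p) := fun p x => by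
    have h := ((p.1.1.hasFDerivAt (x := x)).add
      ((hφ.differentiable (by simp) x).hasFDerivAt.const_mul p.1.2)).const_mul ‖p.1.1‖⁻¹
    have h' : HasFDerivAt (ψ p) _ x := h
    rw [h'.fderiv]
    simp
    ring
  have hcoef : ∀ p : ι, ‖p.1.1‖⁻¹ * |p.1.2| * (D + 1) ≤ 1 / 4 := fun p => by
    have := p.2.2
    rw [mul_assoc, inv_mul_le_iff₀ (hpos p)]
    linarith
  have hg : UniformlySmooth fun (p : ι) x => fderiv ℝ (ψ p) x (u p) := by
    simp_rw [hfd]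
    refine (UniformlySmooth.const (R := 1) fun p => ?_).add
      (((UniformlySmooth.of_hasCompactSupport hφ hφc).fderiv_apply hu1).const_smul (R := 1 / 4)
        fun p => ?_)
    · rw [norm_mul, norm_inv, norm_norm, inv_mul_le_iff₀ (hpos p), mul_one]
      exact p.1.1.unit_le_opNorm _ (hu1 p)
    · rw [norm_mul, norm_inv, norm_norm, Real.norm_eq_abs]
      refine le_trans (le_mul_of_one_le_right ?_ (by linarith)) (hcoef p)
      exact mul_nonneg (inv_nonneg.2 (norm_nonneg _)) (abs_nonneg _)
  obtain ⟨C, hC⟩ := exists_pow_mul_norm_integral_osc_le μ (c := 1 / 4) hc hψ hu1 hg (by norm_num) N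
    (a := fun _ => η) (UniformlySmooth.of_hasCompactSupport hη hc) (fun _ => subset_rfl) (by
      intro p x _
      rw [hfd]
      have h1 : 1 / 2 ≤ ‖p.1.1‖⁻¹ * p.1.1 (u p) := by
        rw [le_inv_mul_iff₀ (hpos p)]
        linarith [hu p]
      have h2 : |(‖p.1.1‖⁻¹ * p.1.2) • fderiv ℝ φ x (u p)| ≤ 1 / 4 := by
        rw [smul_eq_mul, abs_mul, abs_mul, abs_inv, abs_norm]
        refine le_trans ?_ (hcoef p)
        have : |fderiv ℝ φ x (u p)| ≤ D + 1 :=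
          ((fderiv ℝ φ x).unit_le_opNorm _ (hu1 p)).trans ((hD x).trans (by linarith))
        gcongr
      linarith [(abs_le.1 h2).1])
  refine ⟨C, fun l t hl ht => ?_⟩
  have h := hC ⟨(l, t), hl, ht⟩ ‖l‖
  have hl0 : ‖l‖ ≠ 0 := norm_ne_zero_iff.2 hl
  simpa only [ψ, abs_norm, mul_inv_cancel_left₀ hl0, oscIntegral] using h

/-- Uniform decay of the autocorrelations of `e^{i(ℓ + tφ)} η` along the range of `A`. -/
lemma exists_norm_autocorrelation_le (μ : Measure E) [μ.IsAddHaarMeasure]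
    (hφ : ContDiff ℝ ∞ φ) (hφc : HasCompactSupport φ) {ξ₀ : E} (A : V →L[ℝ] E) {r c : ℝ}
    (hc : 0 < c) (hA : ∀ z : V, z ≠ 0 → ∃ u : E, ‖u‖ ≤ 1 ∧
      ∀ ξ ∈ Metric.closedBall ξ₀ r, ξ + A z ∈ Metric.closedBall ξ₀ r →
        c * ‖z‖ ≤ fderiv ℝ φ (ξ + A z) u - fderiv ℝ φ ξ u)
    (hη : ContDiff ℝ ∞ η) (hs : tsupport η ⊆ Metric.closedBall ξ₀ r) (N : ℕ) :
    ∃ C : ℝ, ∀ (l : E →L[ℝ] ℝ) (t : ℝ) (z : V),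
      (1 + |t| * ‖z‖) ^ N * ‖∫ ξ, (osc (l (ξ + A z) + t * φ (ξ + A z)) * η (ξ + A z)) *
        conj (osc (l ξ + t * φ ξ) * η ξ) ∂μ‖ ≤ C := by
  let ι := {z : V // z ≠ 0}
  have hK := isCompact_closedBall ξ₀ r
  have hηc : HasCompactSupport η := hK.of_isClosed_subset (isClosed_tsupport _) hs
  have hpos : ∀ z : ι, 0 < ‖z.1‖ := fun z => norm_pos_iff.2 z.2
  choose u hu1 hu using fun z : ι => hA z.1 z.2
  let ψ : ι → E → ℝ := fun z ξ => ‖z.1‖⁻¹ • (φ (ξ + A z.1) - φ ξ)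
  have hψ : UniformlySmooth ψ := UniformlySmooth.differenceQuotient (R := ‖A‖)
    (UniformlySmooth.of_hasCompactSupport hφ hφc) fun z => by
      rw [abs_inv, abs_norm, inv_mul_le_iff₀ (hpos z), mul_comm]
      exact A.le_opNorm _
  have hfd : ∀ z x, fderiv ℝ (ψ z) x (u z) =
      ‖z.1‖⁻¹ * (fderiv ℝ φ (x + A z.1) (u z) - fderiv ℝ φ x (u z)) := fun z x => by
    have hd := hφ.differentiable (by simp)
    have h1 : HasFDerivAt (fun y => φ (y + A z.1)) (fderiv ℝ φ (x + A z.1)) x :=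
      (hasFDerivAt_comp_add_right _).2 (hd _).hasFDerivAt
    have h := (h1.sub (hd x).hasFDerivAt).const_smul ‖z.1‖⁻¹
    have h' : HasFDerivAt (ψ z) _ x := h
    rw [h'.fderiv]
    simp
  let a : ι → E → ℂ := fun z ξ => η (ξ + A z.1) • conj (η ξ)
  have ha : UniformlySmooth a :=
    ((UniformlySmooth.of_hasCompactSupport hη hηc).comp_add fun z : ι => A z.1).smul
      (UniformlySmooth.of_hasCompactSupport (Complex.conjCLE.contDiff.comp hη)
        (hηc.comp_left (g := fun w : ℂ => conj w) (map_zero _)))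
  have has : ∀ z, tsupport (a z) ⊆ tsupport η ∩ (fun ξ => ξ + A z.1) ⁻¹' tsupport η := fun z => by
    refine closure_minimal (fun ξ hξ => ?_) ((isClosed_tsupport _).inter
      ((isClosed_tsupport _).preimage (by fun_prop)))
    refine ⟨subset_tsupport _ fun h => hξ ?_, subset_tsupport _ fun h => hξ ?_⟩ <;> simp [a, h]
  obtain ⟨C₁, hC₁⟩ := exists_pow_mul_norm_integral_osc_le μ hK hψ.1 hu1 (hψ.fderiv_apply hu1) hc N
    ha (fun z => ((has z).trans inter_subset_left).trans hs) (fun z x hx => by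
      rw [hfd, le_inv_mul_iff₀ (hpos z), mul_comm]
      exact hu z x (hs (has z hx).1) (hs (has z hx).2))
  obtain ⟨D, hD⟩ := hη.continuous.bounded_above_of_compact_support hηc
  have hD0 : 0 ≤ D := (norm_nonneg _).trans (hD 0)
  refine ⟨2 ^ N * (D * D * μ.real (tsupport η) + (|C₁| + D * D * μ.real (tsupport η))),
    fun l t z => ?_⟩
  set G := ∫ ξ, (osc (l (ξ + A z) + t * φ (ξ + A z)) * η (ξ + A z)) *
        conj (osc (l ξ + t * φ ξ) * η ξ) ∂μ with hG
  have h0 : ‖G‖ ≤ D * D * μ.real (tsupport η) := by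
    refine norm_integral_le_of_support_subset hηc (fun ξ hξ => subset_tsupport _ fun h => hξ ?_)
      fun ξ => ?_
    · simp [h]
    · simp only [norm_mul, norm_osc, one_mul, RCLike.norm_conj]
      exact mul_le_mul (hD _) (hD _) (norm_nonneg _) hD0
  have h1 : (|t| * ‖z‖) ^ N * ‖G‖ ≤ |C₁| + D * D * μ.real (tsupport η) := by
    have hm : 0 ≤ D * D * μ.real (tsupport η) := by positivity
    rcases eq_or_ne z 0 with hz | hz
    · have : (|t| * ‖z‖) ^ N ≤ 1 := pow_le_one₀ (by positivity) (by simp [hz])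
      have := mul_le_mul this h0 (norm_nonneg _) zero_le_one
      linarith [abs_nonneg C₁]
    · have hz0 : ‖z‖ ≠ 0 := norm_ne_zero_iff.2 hz
      have h := hC₁ ⟨z, hz⟩ (t * ‖z‖)
      have e : G = osc (l (A z)) * ∫ ξ, osc (t * ‖z‖ * ψ ⟨z, hz⟩ ξ) * a ⟨z, hz⟩ ξ ∂μ := by
        rw [hG, ← integral_const_mul]
        congr 1 with ξ
        have e1 : t * ‖z‖ * ψ ⟨z, hz⟩ ξ = t * φ (ξ + A z) - t * φ ξ := by
          simp only [ψ, smul_eq_mul]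
          field_simp
        have e2 : l (ξ + A z) + t * φ (ξ + A z) =
            l (A z) + (t * φ (ξ + A z) - t * φ ξ) + (l ξ + t * φ ξ) := by
          rw [map_add]; ring
        have e3 : osc (l ξ + t * φ ξ) * conj (osc (l ξ + t * φ ξ)) = 1 := by
          rw [conj_osc, ← osc_add]; simp [osc]
        rw [e1, e2, osc_add, osc_add, map_mul]
        simp only [a, smul_eq_mul]
        linear_combination (osc (l (A z)) * osc (t * φ (ξ + A z) - t * φ ξ) * η (ξ + A z) *
          conj (η ξ)) * e3
      rw [e, norm_mul, norm_osc, one_mul]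
      rw [abs_mul, abs_norm] at h
      linarith [le_abs_self C₁]
  have hp : (1 + |t| * ‖z‖) ^ N ≤ 2 ^ N * (1 + (|t| * ‖z‖) ^ N) := by
    refine (add_pow_le zero_le_one (by positivity) N).trans ?_
    rw [one_pow]
    gcongr
    · norm_num
    · omega
  calc (1 + |t| * ‖z‖) ^ N * ‖G‖ ≤ 2 ^ N * (1 + (|t| * ‖z‖) ^ N) * ‖G‖ := by gcongr
    _ = 2 ^ N * (‖G‖ + (|t| * ‖z‖) ^ N * ‖G‖) := by ring
    _ ≤ _ := by gcongr

/-- Local stationary phase estimate. -/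
lemma exists_pow_mul_norm_oscIntegral_sq_le [FiniteDimensional ℝ V] [MeasurableSpace V]
    [BorelSpace V] (hφ : ContDiff ℝ ∞ φ) (hφc : HasCompactSupport φ) {ξ₀ : E}
    (A : V →L[ℝ] E) (hA : Function.Injective fun z => fderiv ℝ (fderiv ℝ φ) ξ₀ (A z)) :
    ∃ r > 0, ∀ η : E → ℂ, ContDiff ℝ ∞ η → tsupport η ⊆ Metric.closedBall ξ₀ r →
      ∃ C : ℝ, ∀ (l : E →L[ℝ] ℝ) (t : ℝ), t ≠ 0 →
        |t| ^ Module.finrank ℝ V * ‖oscIntegral μ φ η l t‖ ^ 2 ≤ C := by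
  obtain ⟨r, hr, c, hc, hu⟩ := exists_fderiv_difference_lower_bound hφ A hA
  refine ⟨r, hr, fun η hη hs => ?_⟩
  set k := Module.finrank ℝ V with hk
  let ν : Measure V := Measure.addHaar
  obtain ⟨C₁, hC₁⟩ := exists_norm_autocorrelation_le μ hφ hφc A hc hu hη hs (k + 1)
  obtain ⟨C₂, hC₂0, hC₂⟩ :=
    exists_norm_integral_sq_le_autocorrelation μ ν A (isCompact_closedBall ξ₀ r)
  let J : V → ℝ := fun z => (1 + ‖z‖) ^ (-(k + 1 : ℝ))
  have hJ : Integrable J ν := integrable_one_add_norm (by rw [← hk]; linarith)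
  refine ⟨C₂ * (C₁ * ∫ z, J z ∂ν), fun l t ht => ?_⟩
  have h := hC₂ (fun ξ => osc (l ξ + t * φ ξ) * η ξ) (fun z => C₁ * J (t • z)) ?_ ?_
    ((hJ.comp_smul ht).const_mul C₁) fun z => ?_
  · rw [integral_const_mul, Measure.integral_comp_smul, smul_eq_mul, ← hk, abs_inv, abs_pow] at h
    have ht0 : 0 < |t| ^ k := pow_pos (abs_pos.2 ht) k
    calc |t| ^ k * ‖oscIntegral μ φ η l t‖ ^ 2
        ≤ |t| ^ k * (C₂ * (C₁ * ((|t| ^ k)⁻¹ * ∫ z, J z ∂ν))) := by gcongr; exact h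
      _ = C₂ * (C₁ * ∫ z, J z ∂ν) := by field_simp
  · exact (contDiff_osc.continuous.comp
      (l.continuous.add (continuous_const.mul hφ.continuous))).mul hη.continuous
  · exact fun ξ hξ => hs (subset_tsupport _ (right_ne_zero_of_mul hξ))
  · have e : J (t • z) = ((1 + |t| * ‖z‖) ^ (k + 1))⁻¹ := by
      simp only [J]
      rw [norm_smul, Real.norm_eq_abs, Real.rpow_neg (by positivity), ← Real.rpow_natCast]
      push_cast
      rfl
    rw [e, ← div_eq_mul_inv, le_div_iff₀ (by positivity), mul_comm]
    exact hC₁ l t z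

lemma HasDecay.of_injective [FiniteDimensional ℝ V] [MeasurableSpace V]
    [BorelSpace V] (hφ : ContDiff ℝ ∞ φ) (hφc : HasCompactSupport φ) {ξ₀ : E}
    (A : V →L[ℝ] E) (hA : Function.Injective fun z => fderiv ℝ (fderiv ℝ φ) ξ₀ (A z)) :
    ∃ r > 0, ∀ η : E → ℂ, ContDiff ℝ ∞ η → tsupport η ⊆ Metric.closedBall ξ₀ r →
      HasDecay μ φ (Module.finrank ℝ V) η := by
  obtain ⟨r, hr, h⟩ := exists_pow_mul_norm_oscIntegral_sq_le (μ := μ) hφ hφc A hA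
  refine ⟨r, hr, fun η hη hs => ?_⟩
  set k := Module.finrank ℝ V
  have hηc : HasCompactSupport η :=
    (isCompact_closedBall ξ₀ r).of_isClosed_subset (isClosed_tsupport _) hs
  obtain ⟨C₂, hC₂⟩ := h η hη hs
  obtain ⟨M, hM, C₁, hC₁⟩ := exists_pow_mul_norm_oscIntegral_le (μ := μ) hφ hφc hη hηc k
  obtain ⟨C₀, hC₀⟩ := exists_norm_oscIntegral_le (μ := μ) (φ := φ) hη hηc
  have hC₀0 : 0 ≤ C₀ := (norm_nonneg _).trans (hC₀ 0 0)
  refine ⟨2 ^ k * (C₀ ^ 2 + (C₀ ^ 2 + 2 ^ k * |C₁| * C₀ + (M + 1) ^ k * |C₂|)), fun l t => ?_⟩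
  set I := ‖oscIntegral μ φ η l t‖ with hI
  have hI0 : 0 ≤ I := norm_nonneg _
  have hIC : I ≤ C₀ := hC₀ l t
  have hI2 : I ^ 2 ≤ C₀ ^ 2 := by gcongr
  have n1 : 0 ≤ 2 ^ k * |C₁| * C₀ := by positivity
  have n2 : 0 ≤ (M + 1) ^ k * |C₂| := by positivity
  have n3 : 0 ≤ C₀ ^ 2 := by positivity
  have key : (‖l‖ + |t|) ^ k * I ^ 2 ≤ C₀ ^ 2 + 2 ^ k * |C₁| * C₀ + (M + 1) ^ k * |C₂| := by
    rcases le_or_gt (M * |t|) ‖l‖ with hl | hl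
    · rcases eq_or_ne l 0 with h0 | h0
      · have ht : |t| ≤ 0 := by
          rw [h0, norm_zero] at hl
          nlinarith [abs_nonneg t]
        have h1 : (‖l‖ + |t|) ^ k ≤ 1 :=
          pow_le_one₀ (by positivity) (by rw [h0, norm_zero]; linarith)
        have := mul_le_mul h1 hI2 (by positivity) zero_le_one
        linarith
      · have h1 : ‖l‖ + |t| ≤ 2 * ‖l‖ := by nlinarith [abs_nonneg t]
        have h2 : ‖l‖ ^ k * I ≤ |C₁| := (hC₁ l t h0 hl).trans (le_abs_self _)
        calc (‖l‖ + |t|) ^ k * I ^ 2 ≤ (2 * ‖l‖) ^ k * I ^ 2 := by gcongr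
          _ = 2 ^ k * (‖l‖ ^ k * I) * I := by rw [mul_pow]; ring
          _ ≤ 2 ^ k * |C₁| * C₀ := by gcongr
          _ ≤ _ := by linarith
    · have ht : t ≠ 0 := by
        rintro rfl
        simp only [abs_zero, mul_zero] at hl
        exact (norm_nonneg l).not_gt hl
      have h1 : ‖l‖ + |t| ≤ (M + 1) * |t| := by linarith
      have h2 : |t| ^ k * I ^ 2 ≤ |C₂| := (hC₂ l t ht).trans (le_abs_self _)
      calc (‖l‖ + |t|) ^ k * I ^ 2 ≤ ((M + 1) * |t|) ^ k * I ^ 2 := by gcongr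
        _ = (M + 1) ^ k * (|t| ^ k * I ^ 2) := by rw [mul_pow]; ring
        _ ≤ (M + 1) ^ k * |C₂| := by gcongr
        _ ≤ _ := by linarith
  have hp : (1 + ‖l‖ + |t|) ^ k ≤ 2 ^ k * (1 + (‖l‖ + |t|) ^ k) := by
    rw [add_assoc]
    refine (add_pow_le zero_le_one (by positivity) k).trans ?_
    rw [one_pow]
    gcongr
    · norm_num
    · omega
  calc (1 + ‖l‖ + |t|) ^ k * I ^ 2 ≤ 2 ^ k * (1 + (‖l‖ + |t|) ^ k) * I ^ 2 := by gcongr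
    _ = 2 ^ k * (I ^ 2 + (‖l‖ + |t|) ^ k * I ^ 2) := by ring
    _ ≤ _ := by gcongr

/-- Decay for amplitudes supported near each point of the support implies decay. -/
lemma HasDecay.of_local {k : ℕ} (hφ : ContDiff ℝ ∞ φ) (hη : ContDiff ℝ ∞ η)
    (hc : HasCompactSupport η)
    (hloc : ∀ ξ ∈ tsupport η, ∃ r > 0, ∀ η' : E → ℂ, ContDiff ℝ ∞ η' →
      tsupport η' ⊆ Metric.closedBall ξ r → HasDecay μ φ k η') : HasDecay μ φ k η := by
  classical
  choose! r hr hdec using hloc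
  obtain ⟨s, hs, hcov⟩ := hc.elim_nhds_subcover (fun ξ => Metric.ball ξ (r ξ / 2))
    fun ξ hξ => Metric.ball_mem_nhds _ (half_pos (hr ξ hξ))
  replace hcov := (subset_tsupport η).trans hcov
  have hgood : ∀ ξ ∈ s, 0 < r ξ ∧ ∀ η' : E → ℂ, ContDiff ℝ ∞ η' →
      tsupport η' ⊆ Metric.closedBall ξ (r ξ) → HasDecay μ φ k η' :=
    fun ξ hξ => ⟨hr ξ (hs ξ hξ), hdec ξ (hs ξ hξ)⟩
  clear hs hdec hr
  induction s using Finset.induction_on generalizing η with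
  | empty =>
    have : η = 0 := Function.support_eq_empty_iff.1 (by simpa using hcov)
    exact ⟨0, fun l t => by simp [oscIntegral, this]⟩
  | insert ξ s _ ih =>
    obtain ⟨hrpos, hdecξ⟩ := hgood ξ (Finset.mem_insert_self _ _)
    let f : ContDiffBump ξ := ⟨r ξ / 2, r ξ, half_pos hrpos, half_lt_self hrpos⟩
    have hf : ContDiff ℝ ∞ f := f.contDiff
    have h1 : ContDiff ℝ ∞ fun x => f x • η x := hf.smul hη
    have h2 : ContDiff ℝ ∞ fun x => (1 - f x) • η x := (contDiff_const.sub hf).smul hη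
    have h2c : HasCompactSupport fun x => (1 - f x) • η x := hc.smul_left (f := fun x => 1 - f x)
    have hd1 := hdecξ _ h1 ((tsupport_smul_subset_left f η).trans f.tsupport_eq.subset)
    have hd2 := ih h2 h2c (fun x hx => by
        have hx' := hcov (right_ne_zero_of_smul hx)
        rw [Finset.set_biUnion_insert] at hx'
        refine hx'.resolve_left fun hb => hx ?_
        simp [f.one_of_mem_closedBall (Metric.ball_subset_closedBall hb)])
      fun ζ hζ => hgood ζ (Finset.mem_insert_of_mem hζ)
    convert HasDecay.add hφ h1 (hc.smul_left (f := f)) h2 h2c hd1 hd2 using 2 with x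
    rw [← add_smul]
    simp

end Decay

lemma exists_injective_comp_of_le_finrank_range {E W : Type*} [AddCommGroup E] [Module ℝ E]
    [AddCommGroup W] [Module ℝ W] (T : E →ₗ[ℝ] W) {k : ℕ}
    (hk : k ≤ Module.finrank ℝ (LinearMap.range T)) :
    ∃ A : (Fin k → ℝ) →ₗ[ℝ] E, Function.Injective fun z => T (A z) := by
  obtain ⟨f, hf⟩ := exists_linearIndependent_of_le_finrank hk
  choose u hu using fun i => (f i).2
  have hli : LinearIndependent ℝ fun i => T (u i) := by
    simp_rw [hu]
    exact hf.map' (LinearMap.range T).subtype (Submodule.ker_subtype _)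
  refine ⟨Fintype.linearCombination ℝ u, ?_⟩
  have := hli.fintypeLinearCombination_injective
  convert this using 2 with z
  simp [Fintype.linearCombination_apply]

lemma hess_apply {n : ℕ} {φ : (Fin n → ℝ) → ℝ} (hφ : ContDiff ℝ ∞ φ) (ξ : Fin n → ℝ)
    (i j : Fin n) :
    hess n φ ξ i j = fderiv ℝ (fderiv ℝ φ) ξ (Pi.single i 1) (Pi.single j 1) := by
  have h : DifferentiableAt ℝ (fderiv ℝ φ) ξ :=
    (hφ.fderiv_right (m := ∞) (by simp)).differentiable (by simp) ξ
  rw [hess, fderiv_clm_apply h (differentiableAt_const _)]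
  simp

lemma exists_injective_of_le_rank_hess {n k : ℕ} {φ : (Fin n → ℝ) → ℝ} (hφ : ContDiff ℝ ∞ φ)
    {ξ : Fin n → ℝ} (hk : k ≤ (hess n φ ξ).rank) :
    ∃ A : (Fin k → ℝ) →L[ℝ] (Fin n → ℝ),
      Function.Injective fun z => fderiv ℝ (fderiv ℝ φ) ξ (A z) := by
  rw [← Matrix.rank_transpose] at hk
  obtain ⟨A, hA⟩ := exists_injective_comp_of_le_finrank_range _ hk
  refine ⟨LinearMap.toContinuousLinearMap A, fun z w hzw => hA ?_⟩
  have key : ∀ v : Fin n → ℝ, (hess n φ ξ).transpose.mulVecLin v =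
      fun j => fderiv ℝ (fderiv ℝ φ) ξ v (Pi.single j 1) := fun v => by
    ext j
    conv_rhs => rw [pi_eq_sum_univ' v]
    simp only [Matrix.mulVecLin_apply, Matrix.mulVec, dotProduct, Matrix.transpose_apply,
      hess_apply hφ, map_sum, map_smul, sum_apply,
      smul_apply, smul_eq_mul]
    exact Finset.sum_congr rfl fun i _ => mul_comm _ _
  simp only [key]
  ext j
  exact congrArg (fun L : (Fin n → ℝ) →L[ℝ] ℝ => L (Pi.single j 1)) hzw

lemma exists_hasCompactSupport_eqOn {E : Type*} [NormedAddCommGroup E] [NormedSpace ℝ E]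
    [FiniteDimensional ℝ E] {φ : E → ℝ} (hφ : ContDiff ℝ ∞ φ) {K : Set E} (hK : IsCompact K) :
    ∃ φ' : E → ℝ, ContDiff ℝ ∞ φ' ∧ HasCompactSupport φ' ∧
      ∃ U : Set E, IsOpen U ∧ K ⊆ U ∧ EqOn φ' φ U := by
  obtain ⟨R, hR, hKR⟩ := hK.isBounded.subset_ball_lt 0 0
  let f : ContDiffBump (0 : E) := ⟨R, R + 1, hR, lt_add_one R⟩
  have hf : ContDiff ℝ ∞ f := f.contDiff
  refine ⟨fun x => f x * φ x, hf.mul hφ, f.hasCompactSupport.mul_right, Metric.ball 0 R,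
    Metric.isOpen_ball, hKR, fun x hx => ?_⟩
  simp [f.one_of_mem_closedBall (Metric.ball_subset_closedBall hx)]

/-- Stationary phase estimate for phases whose Hessian has rank at least `k` on the support of the
amplitude. -/
lemma hasDecay_of_le_rank_hess {n k : ℕ} {η : (Fin n → ℝ) → ℂ} {φ : (Fin n → ℝ) → ℝ}
    (hη : ContDiff ℝ ∞ η) (hc : HasCompactSupport η) (hφ : ContDiff ℝ ∞ φ)
    (hrank : ∀ ξ ∈ tsupport η, k ≤ (hess n φ ξ).rank) : HasDecay volume φ k η := by
  obtain ⟨φ', hφ', hφc, U, hU, hηU, heq⟩ := exists_hasCompactSupport_eqOn hφ hc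
  have hdec : HasDecay volume φ' k η := by
    refine HasDecay.of_local hφ' hη hc fun ξ hξ => ?_
    obtain ⟨A, hA⟩ := exists_injective_of_le_rank_hess hφ (hrank ξ hξ)
    have hev : φ' =ᶠ[nhds ξ] φ := heq.eventuallyEq_of_mem (hU.mem_nhds (hηU hξ))
    rw [← hev.fderiv.fderiv_eq] at hA
    simpa using HasDecay.of_injective hφ' hφc A hA
  obtain ⟨C, hC⟩ := hdec
  refine ⟨C, fun l t => ?_⟩
  have e : oscIntegral volume φ η l t = oscIntegral volume φ' η l t := by
    refine integral_congr_ae (.of_forall fun ξ => ?_)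
    by_cases hξ : η ξ = 0
    · simp [hξ]
    · simp only [show φ' ξ = φ ξ from heq (hηU (subset_tsupport _ hξ))]
  rw [e]
  exact hC l t

lemma sqrt_sum_sq_add_sq_le {n : ℕ} (x : Fin n → ℝ) (t : ℝ) :
    Real.sqrt ((∑ i, (x i) ^ 2) + t ^ 2) ≤
      n * ‖∑ i, x i • (ContinuousLinearMap.proj i : (Fin n → ℝ) →L[ℝ] ℝ)‖ + |t| := by
  set l := ∑ i, x i • (ContinuousLinearMap.proj i : (Fin n → ℝ) →L[ℝ] ℝ) with hl
  have hx : ∀ i, |x i| ≤ ‖l‖ := fun i => by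
    have h : l (Pi.single i 1) = x i := by simp [hl, Pi.single_apply, sum_apply]
    rw [← h]
    exact l.unit_le_opNorm (Pi.single i 1) (by simp [Pi.norm_single])
  have hs : ∑ i, |x i| ≤ n * ‖l‖ := by
    simpa using Finset.sum_le_sum fun i (_ : i ∈ Finset.univ) => hx i
  refine (Real.sqrt_le_left (by positivity)).2 ?_
  have h1 : ∑ i, (x i) ^ 2 ≤ (∑ i, |x i|) ^ 2 := by
    simpa using Finset.sum_sq_le_sq_sum_of_nonneg fun i (_ : i ∈ Finset.univ) => abs_nonneg (x i)
  have h2 : (∑ i, |x i|) ^ 2 ≤ (n * ‖l‖) ^ 2 := by gcongr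
  have h3 : 0 ≤ n * ‖l‖ * |t| := by positivity
  nlinarith [sq_abs t]

lemma le_sqrt_mul_rpow_neg_half {a s C : ℝ} {k : ℕ} (hs : 0 < s) (h : s ^ k * a ^ 2 ≤ C) :
    a ≤ Real.sqrt C * s ^ (-(k : ℝ) / 2) := by
  have hp : 0 < s ^ (-(k : ℝ) / 2) := Real.rpow_pos_of_pos hs _
  have hsq : (s ^ (-(k : ℝ) / 2)) ^ 2 = (s ^ k)⁻¹ := by
    rw [← Real.rpow_natCast, ← Real.rpow_mul hs.le, ← Real.rpow_natCast s, ← Real.rpow_neg hs.le]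
    congr 1
    push_cast
    ring
  rw [← div_le_iff₀ hp]
  refine Real.le_sqrt_of_sq_le ?_
  rw [div_pow, hsq, div_inv_eq_mul, mul_comm]
  exact h

/-- stationary-phase kernel decay. If `η` is smooth with compact
support and the Hessian of the smooth phase `φ` has rank `≥ k` on the support of
`η`, then `|∫ e^{i(x·ξ + tφ(ξ))} η(ξ) dξ| ≤ C (1 + |(x,t)|)^{-k/2}`. -/
theorem statement_11 (n k : ℕ) (η : (Fin n → ℝ) → ℂ) (φ : (Fin n → ℝ) → ℝ)
    (hη : ContDiff ℝ (⊤ : ℕ∞) η) (hηc : HasCompactSupport η) (hφ : ContDiff ℝ (⊤ : ℕ∞) φ)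
    (hrank : ∀ ξ ∈ tsupport η, k ≤ (hess n φ ξ).rank) :
    ∃ C : ℝ, ∀ (x : Fin n → ℝ) (t : ℝ),
      ‖∫ ξ : Fin n → ℝ,
          Complex.exp (Complex.I * (((∑ i, x i * ξ i) + t * φ ξ : ℝ) : ℂ)) * η ξ‖ ≤
        C * (1 + Real.sqrt ((∑ i, (x i) ^ 2) + t ^ 2)) ^ (-(k : ℝ) / 2) := by
  obtain ⟨C, hC⟩ := hasDecay_of_le_rank_hess hη hηc hφ hrank
  refine ⟨Real.sqrt ((n + 1) ^ k * C), fun x t => le_sqrt_mul_rpow_neg_half (by positivity) ?_⟩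
  set l := ∑ i, x i • (ContinuousLinearMap.proj i : (Fin n → ℝ) →L[ℝ] ℝ) with hl
  have e : ∫ ξ : Fin n → ℝ,
      Complex.exp (Complex.I * (((∑ i, x i * ξ i) + t * φ ξ : ℝ) : ℂ)) * η ξ =
        oscIntegral volume φ η l t := by
    simp [oscIntegral, osc, hl, sum_apply]
  have hle : 1 + Real.sqrt ((∑ i, (x i) ^ 2) + t ^ 2) ≤ (n + 1) * (1 + ‖l‖ + |t|) := by
    have h := sqrt_sum_sq_add_sq_le x t
    have h1 : 0 ≤ n * |t| := by positivity
    have h2 : (0 : ℝ) ≤ n := by positivity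
    have h3 := norm_nonneg l
    linarith
  rw [e]
  calc _ ≤ ((n + 1) * (1 + ‖l‖ + |t|)) ^ k * ‖oscIntegral volume φ η l t‖ ^ 2 := by gcongr
    _ = (n + 1) ^ k * ((1 + ‖l‖ + |t|) ^ k * ‖oscIntegral volume φ η l t‖ ^ 2) := by
      rw [mul_pow, mul_assoc]
    _ ≤ _ := by gcongr; exact hC l t
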